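/- arXiv:2105.00138 — 10 statements merged into one kernel-verified Lean document; each statement's English description precedes it below -/
import Mathlib

section
/- The smocking pseudometric d̄ is a pseudometric on ℝ^N: for all u, v, w ∈ ℝ^N one has d̄(v, v) = 0, d̄(v, w) = d̄(w, v), and d̄(v, w) ≤ d̄(v, u) + d̄(u, w). -/
open scoped ENNReal NNReal
open Metric Set Filter MeasureTheory

noncomputable section

abbrev E (N : ℕ) : Type := EuclideanSpace ℝ (Fin N)

/-- The set of costs of chains jumping through `m + 1` stitches (with consecutive
stitches distinct) from `v` to `w`. -/
def chainCosts {N : ℕ} {J : Type*} (I : J → Set (E N)) (m : ℕ) (v w : E N) :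
    Set ℝ≥0∞ :=
  {c | ∃ (j : Fin (m + 1) → J) (z z' : Fin (m + 1) → E N),
    (∀ i, z i ∈ I (j i)) ∧ (∀ i, z' i ∈ I (j i)) ∧
    (∀ i : Fin m, j i.castSucc ≠ j i.succ) ∧
    c = edist v (z 0) + (∑ i : Fin m, edist (z' i.castSucc) (z i.succ)) +
        edist (z' (Fin.last m)) w}

/-- `dk I k v w` is the infimum of lengths of paths from `v` to `w` jumping through
exactly `k` stitches (it is `∞` when no such chain exists). -/
def dk {N : ℕ} {J : Type*} (I : J → Set (E N)) : ℕ → E N → E N → ℝ≥0∞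
  | 0 => fun v w => edist v w
  | (m + 1) => fun v w => sInf (chainCosts I m v w)

/-- The smocking pseudometric `d̄`. -/
def dbar {N : ℕ} {J : Type*} (I : J → Set (E N)) (v w : E N) : ℝ≥0∞ :=
  ⨅ k, dk I k v w

theorem dbar_le_edist {N : ℕ} {J : Type*} (I : J → Set (E N)) (v w : E N) :
    dbar I v w ≤ edist v w :=
  iInf_le (fun k => dk I k v w) 0

theorem dbar_le_of_mem_chainCosts {N : ℕ} {J : Type*} {I : J → Set (E N)} {m : ℕ} {v w : E N}
    {c : ℝ≥0∞} (hc : c ∈ chainCosts I m v w) : dbar I v w ≤ c :=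
  (iInf_le (fun k => dk I k v w) (m + 1)).trans (sInf_le hc)

/-- A lower bound for the direct distance and for all chain costs, up to an additive constant,
is a lower bound for `dbar` up to the same constant. -/
theorem le_add_dbar {N : ℕ} {J : Type*} {I : J → Set (E N)} {v w : E N} {a b : ℝ≥0∞}
    (h0 : a ≤ b + edist v w) (h : ∀ m, ∀ c ∈ chainCosts I m v w, a ≤ b + c) :
    a ≤ b + dbar I v w := by
  rw [dbar, ENNReal.add_iInf]
  refine le_iInf fun k => ?_
  cases k with
  | zero => exact h0
  | succ m =>
    simp only [dk]
    rw [ENNReal.add_sInf]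
    exact le_iInf₂ fun c hc => h m c hc

theorem dbar_le_edist_add {N : ℕ} {J : Type*} (I : J → Set (E N)) (v u w : E N) :
    dbar I v w ≤ edist v u + dbar I u w := by
  refine le_add_dbar ((dbar_le_edist I v w).trans (edist_triangle _ _ _)) ?_
  rintro m _ ⟨j, z, z', hz, hz', hj, rfl⟩
  refine (dbar_le_of_mem_chainCosts ⟨j, z, z', hz, hz', hj, rfl⟩).trans ?_
  rw [← add_assoc, ← add_assoc]
  gcongr
  exact edist_triangle _ _ _

theorem dbar_le_edist_add_of_mem {N : ℕ} {J : Type*} {I : J → Set (E N)} {i : J} {x x' : E N}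
    (hx : x ∈ I i) (hx' : x' ∈ I i) (v w : E N) :
    dbar I v w ≤ edist v x + dbar I x' w := by
  refine le_add_dbar (dbar_le_of_mem_chainCosts (m := 0) ⟨fun _ => i, fun _ => x, fun _ => x',
    fun _ => hx, fun _ => hx', fun k => k.elim0, by simp⟩) ?_
  rintro m _ ⟨j, z, z', hz, hz', hj, rfl⟩
  by_cases hi : i = j 0
  · subst hi
    refine (dbar_le_of_mem_chainCosts (m := m) ⟨j, Function.update z 0 x, z', fun k => ?_, hz',
      hj, rfl⟩).trans ?_
    · by_cases hk : k = 0
      · subst hk; simpa using hx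
      · simpa [Function.update_of_ne hk] using hz k
    · simp only [Function.update_self, Function.update_of_ne (Fin.succ_ne_zero _), ← add_assoc]
      gcongr
      exact le_self_add
  · refine (dbar_le_of_mem_chainCosts (m := m + 1) ⟨Fin.cons i j, Fin.cons x z, Fin.cons x' z',
      Fin.cases hx hz, Fin.cases hx' hz', Fin.cases ?_ fun k => ?_, rfl⟩).trans (le_of_eq ?_)
    · rw [Fin.sum_univ_succ, ← Fin.succ_last]
      simp only [Fin.castSucc_zero, Fin.castSucc_succ, Fin.cons_zero, Fin.cons_succ, add_assoc]
    · simpa using hi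
    · rw [Fin.castSucc_succ]
      simpa using hj k

theorem dbar_le_chainCosts_add {N : ℕ} {J : Type*} {I : J → Set (E N)} {u w : E N} (m : ℕ) :
    ∀ (v : E N), ∀ c ∈ chainCosts I m v u, dbar I v w ≤ dbar I u w + c := by
  induction m with
  | zero =>
    rintro v _ ⟨j, z, z', hz, hz', -, rfl⟩
    refine (dbar_le_edist_add_of_mem (hz 0) (hz' 0) v w).trans ?_
    refine (add_le_add_right (dbar_le_edist_add I (z' 0) u w) _).trans (le_of_eq ?_)
    simp only [Finset.univ_eq_empty, Finset.sum_empty, add_zero, Fin.last_zero]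
    ring
  | succ m ih =>
    rintro v _ ⟨j, z, z', hz, hz', hj, rfl⟩
    refine (dbar_le_edist_add_of_mem (hz 0) (hz' 0) v w).trans ?_
    refine (add_le_add_right (ih (z' 0) _ ⟨Fin.tail j, Fin.tail z, Fin.tail z',
      fun k => hz k.succ, fun k => hz' k.succ, fun k => hj k.succ, rfl⟩) _).trans (le_of_eq ?_)
    rw [Fin.sum_univ_succ, ← Fin.succ_last]
    simp only [Fin.castSucc_zero, Fin.castSucc_succ, Fin.tail, Fin.succ_zero_eq_one]
    ring

theorem dbar_triangle {N : ℕ} {J : Type*} (I : J → Set (E N)) (v u w : E N) :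
    dbar I v w ≤ dbar I v u + dbar I u w := by
  rw [add_comm]
  refine le_add_dbar ?_ fun m => dbar_le_chainCosts_add m v
  rw [add_comm]
  exact dbar_le_edist_add I v u w

theorem chainCosts_subset_swap {N : ℕ} {J : Type*} (I : J → Set (E N)) (m : ℕ) (v w : E N) :
    chainCosts I m v w ⊆ chainCosts I m w v := by
  rintro _ ⟨j, z, z', hz, hz', hj, rfl⟩
  refine ⟨j ∘ Fin.rev, z' ∘ Fin.rev, z ∘ Fin.rev, fun k => hz' _, fun k => hz _, fun k => ?_, ?_⟩
  · simpa [Fin.rev_castSucc, Fin.rev_succ] using (hj k.rev).symm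
  · have hsum : ∑ k : Fin m, edist (z (k.castSucc.rev)) (z' (k.succ.rev)) =
        ∑ k : Fin m, edist (z' k.castSucc) (z k.succ) := by
      rw [← Equiv.sum_comp Fin.revPerm]
      simp [Fin.rev_castSucc, Fin.rev_succ, edist_comm]
    simp only [Function.comp_apply, hsum, Fin.rev_zero, Fin.rev_last]
    rw [edist_comm w, edist_comm (z 0)]
    ring

theorem dbar_comm {N : ℕ} {J : Type*} (I : J → Set (E N)) (v w : E N) :
    dbar I v w = dbar I w v := by
  refine iInf_congr fun k => ?_
  cases k with
  | zero => exact edist_comm v w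
  | succ m =>
    exact congrArg sInf
      ((chainCosts_subset_swap I m v w).antisymm (chainCosts_subset_swap I m w v))

/-- the smocking pseudometric is a pseudometric on ℝ^N: it vanishes on
the diagonal, is symmetric, and satisfies the triangle inequality. -/
theorem smocking_pseudometric
    {N : ℕ} (hN : 1 ≤ N) {J : Type} [Countable J] (I : J → Set (E N))
    (hne : ∀ j, (I j).Nonempty) (hcpt : ∀ j, IsCompact (I j))
    (hconn : ∀ j, IsConnected (I j))
    (hdisj : Pairwise fun j j' => Disjoint (I j) (I j'))
    (hsep : ∃ δ : ℝ, 0 < δ ∧ ∀ j j', j ≠ j' → ∀ z ∈ I j, ∀ z' ∈ I j', δ ≤ dist z z') :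
    ∀ u v w : E N,
      dbar I v v = 0 ∧ dbar I v w = dbar I w v ∧
      dbar I v w ≤ dbar I v u + dbar I u w := by
  intro u v w
  exact ⟨le_antisymm ((dbar_le_edist I v v).trans (edist_self v).le) bot_le, dbar_comm I v w,
    dbar_triangle I v u w⟩
end
end

section
/- For all v, w ∈ ℝ^N there exists a natural number k with k ≤ ⌊|v − w|/δ⌋ + 1 such that d̄(v, w) = d_k(v, w) and d_k(v, w) ≤ d_m(v, w) for every m ≥ 0; moreover the infimum defining d_k(v, w) is attained by some choice of indices j_1, …, j_k and points z_i, z'_i ∈ I_{j_i}. In particular the infimum defining the smocking pseudometric is a minimum. -/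
open scoped ENNReal NNReal
open Metric Set Filter MeasureTheory

noncomputable section

/-- A family of sets that are pairwise at distance at least `δ > 0` is locally finite. -/
theorem locallyFinite_of_separated {X J : Type*} [PseudoMetricSpace X] {I : J → Set X} {δ : ℝ}
    (hδ : 0 < δ) (hsep : ∀ j j', j ≠ j' → ∀ z ∈ I j, ∀ z' ∈ I j', δ ≤ dist z z') :
    LocallyFinite I := by
  intro x
  refine ⟨ball x (δ / 2), ball_mem_nhds x (by positivity), Set.Subsingleton.finite ?_⟩
  rintro j ⟨z, hz, hzx⟩ j' ⟨z', hz', hzx'⟩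
  by_contra hne
  have h1 := hsep j j' hne z hz z' hz'
  have h2 := dist_triangle_right z z' x
  rw [mem_ball] at hzx hzx'
  linarith

/-- A set containing every point of the `n`-th stitch of any chain which starts at `v` and has
all its jumps of length at most `R`. -/
def reachSet {X J : Type*} [PseudoMetricSpace X] (I : J → Set X) (R : ℝ) (v : X) : ℕ → Set X
  | 0 => {v}
  | n + 1 => ⋃ j ∈ {j | (I j ∩ cthickening R (reachSet I R v n)).Nonempty}, I j

theorem isCompact_reachSet {X J : Type*} [PseudoMetricSpace X] [ProperSpace X] {I : J → Set X}
    (hI : LocallyFinite I) (hcpt : ∀ j, IsCompact (I j)) (R : ℝ) (v : X) (n : ℕ) :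
    IsCompact (reachSet I R v n) := by
  induction n with
  | zero => exact isCompact_singleton
  | succ n ih =>
    exact (hI.finite_nonempty_inter_compact ih.cthickening).isCompact_biUnion fun j _ => hcpt j

theorem nonempty_inter_cthickening_reachSet {X J : Type*} [PseudoMetricSpace X] {I : J → Set X}
    {R : ℝ} {v : X} {m : ℕ} {j : Fin (m + 1) → J} {z z' : Fin (m + 1) → X}
    (hz : ∀ i, z i ∈ I (j i)) (hz' : ∀ i, z' i ∈ I (j i)) (h0 : dist v (z 0) ≤ R)
    (hs : ∀ i : Fin m, dist (z' i.castSucc) (z i.succ) ≤ R) (i : Fin (m + 1)) :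
    (I (j i) ∩ cthickening R (reachSet I R v i)).Nonempty := by
  induction i using Fin.induction with
  | zero =>
    exact ⟨z 0, hz 0, mem_cthickening_of_dist_le _ v _ _ rfl (by rwa [dist_comm])⟩
  | succ i ih =>
    refine ⟨z i.succ, hz _, mem_cthickening_of_dist_le _ (z' i.castSucc) _ _ ?_
      (by rw [dist_comm]; exact hs i)⟩
    rw [Fin.val_succ]
    exact mem_biUnion (x := j i.castSucc) ih (hz' _)

/-- If some chain is shorter than `R`, then a shortest chain with the same number of stitches
exists. -/
theorem sInf_chainCosts_mem {N : ℕ} {J : Type*} {I : J → Set (E N)} (hI : LocallyFinite I)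
    (hcpt : ∀ j, IsCompact (I j)) {m : ℕ} {v w : E N} {R : ℝ} (hR : 0 ≤ R)
    (hlt : sInf (chainCosts I m v w) < ENNReal.ofReal R) :
    sInf (chainCosts I m v w) ∈ chainCosts I m v w := by
  let cost : (Fin (m + 1) → E N) × (Fin (m + 1) → E N) → ℝ≥0∞ := fun p =>
    edist v (p.1 0) + (∑ i : Fin m, edist (p.2 i.castSucc) (p.1 i.succ)) +
      edist (p.2 (Fin.last m)) w
  have hcont : Continuous cost := by fun_prop
  let T : Set (Fin (m + 1) → J) :=
    {j | (∀ i : Fin (m + 1), j i ∈ {a | (I a ∩ cthickening R (reachSet I R v i)).Nonempty}) ∧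
      ∀ i : Fin m, j i.castSucc ≠ j i.succ}
  have hTfin : T.Finite := by
    refine (Set.Finite.pi' fun i : Fin (m + 1) =>
      hI.finite_nonempty_inter_compact
        (isCompact_reachSet hI hcpt R v i).cthickening).subset fun j hj => hj.1
  set C : Set ℝ≥0∞ := ⋃ j ∈ T, cost ''
    ((univ.pi fun i => I (j i)) ×ˢ (univ.pi fun i => I (j i))) with hC
  have hCcpt : IsCompact C := hTfin.isCompact_biUnion fun j _ =>
    ((isCompact_univ_pi fun i => hcpt (j i)).prod
      (isCompact_univ_pi fun i => hcpt (j i))).image hcont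
  have hCsub : C ⊆ chainCosts I m v w := by
    intro c hc
    simp only [hC, mem_iUnion] at hc
    obtain ⟨j, hj, p, ⟨hp1, hp2⟩, rfl⟩ := hc
    exact ⟨j, p.1, p.2, fun i => hp1 i trivial, fun i => hp2 i trivial, hj.2, rfl⟩
  have hsub : ∀ c ∈ chainCosts I m v w, c ≤ ENNReal.ofReal R → c ∈ C := by
    rintro c ⟨j, z, z', hz, hz', hj, rfl⟩ hc
    have h0 : dist v (z 0) ≤ R := by
      rw [← edist_le_ofReal hR]
      exact (le_self_add.trans le_self_add).trans hc
    have hs : ∀ i : Fin m, dist (z' i.castSucc) (z i.succ) ≤ R := fun i => by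
      rw [← edist_le_ofReal hR]
      refine le_trans ?_ hc
      refine le_trans (Finset.single_le_sum
        (f := fun i : Fin m => edist (z' i.castSucc) (z i.succ))
        (fun _ _ => zero_le) (Finset.mem_univ i)) ?_
      exact le_add_self.trans le_self_add
    exact mem_biUnion (x := j) ⟨nonempty_inter_cthickening_reachSet hz hz' h0 hs, hj⟩
      ⟨(z, z'), ⟨fun i _ => hz i, fun i _ => hz' i⟩, rfl⟩
  obtain ⟨c, hc, hcR⟩ := sInf_lt_iff.1 hlt
  have hmem : sInf C ∈ C := hCcpt.sInf_mem ⟨c, hsub c hc hcR.le⟩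
  have heq : sInf (chainCosts I m v w) = sInf C := by
    refine le_antisymm (sInf_le_sInf hCsub) (le_sInf fun b hb => ?_)
    rcases le_total b (ENNReal.ofReal R) with h | h
    · exact sInf_le (hsub b hb h)
    · exact (sInf_le (hsub c hc hcR.le)).trans (hcR.le.trans h)
  rw [heq]
  exact hCsub hmem

/-- Each of the `m` jumps between the stitches of a chain has length at least `δ`. -/
theorem mul_le_sInf_chainCosts {N : ℕ} {J : Type*} {I : J → Set (E N)} {δ : ℝ}
    (hsep : ∀ j j', j ≠ j' → ∀ z ∈ I j, ∀ z' ∈ I j', δ ≤ dist z z') (m : ℕ) (v w : E N) :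
    ENNReal.ofReal (m * δ) ≤ sInf (chainCosts I m v w) := by
  refine le_sInf ?_
  rintro c ⟨j, z, z', hz, hz', hj, rfl⟩
  calc ENNReal.ofReal (m * δ) = ∑ _i : Fin m, ENNReal.ofReal δ := by
        rw [ENNReal.ofReal_mul (Nat.cast_nonneg m)]
        simp
    _ ≤ ∑ i : Fin m, edist (z' i.castSucc) (z i.succ) := by
        refine Finset.sum_le_sum fun i _ => ?_
        rw [edist_dist]
        exact ENNReal.ofReal_le_ofReal (hsep _ _ (hj i) _ (hz' _) _ (hz _))
    _ ≤ _ := le_add_self.trans le_self_add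

/-- the infimum defining the smocking pseudometric is achieved at some
`k ≤ ⌊|v - w|/δ⌋ + 1`, and the infimum defining `dk` at that `k` is attained by an
actual chain of stitches. -/
theorem smocking_pseudometric_min_attained
    {N : ℕ} (hN : 1 ≤ N) {J : Type} [Countable J] (I : J → Set (E N))
    (hne : ∀ j, (I j).Nonempty) (hcpt : ∀ j, IsCompact (I j))
    (hconn : ∀ j, IsConnected (I j))
    (hdisj : Pairwise fun j j' => Disjoint (I j) (I j'))
    (δ : ℝ) (hδ : 0 < δ)
    (hsep : ∀ j j', j ≠ j' → ∀ z ∈ I j, ∀ z' ∈ I j', δ ≤ dist z z') :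
    ∀ v w : E N, ∃ k : ℕ, k ≤ Nat.floor (dist v w / δ) + 1 ∧
      dbar I v w = dk I k v w ∧
      (∀ m : ℕ, dk I k v w ≤ dk I m v w) ∧
      (k = 0 ∨ ∃ m : ℕ, k = m + 1 ∧ dk I k v w ∈ chainCosts I m v w) := by
  intro v w
  set K := Nat.floor (dist v w / δ) + 1
  obtain ⟨k, hkK, hkmin⟩ := (Finset.range (K + 1)).exists_min_image (fun k => dk I k v w)
    ⟨0, by simp⟩
  have hmin : ∀ m, dk I k v w ≤ dk I m v w := by
    intro m
    by_cases hm : m ≤ K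
    · exact hkmin m (Finset.mem_range.2 (by omega))
    · obtain ⟨n, rfl⟩ : ∃ n, m = n + 1 := ⟨m - 1, by omega⟩
      have hn : dist v w / δ < n :=
        (Nat.lt_floor_add_one _).trans_le (by exact_mod_cast (by omega : K ≤ n))
      calc dk I k v w ≤ edist v w := hkmin 0 (by simp)
        _ ≤ ENNReal.ofReal (n * δ) := by
          rw [edist_dist]
          exact ENNReal.ofReal_le_ofReal ((div_lt_iff₀ hδ).1 hn).le
        _ ≤ dk I (n + 1) v w := mul_le_sInf_chainCosts hsep n v w
  have hbar : ∀ k, (∀ m, dk I k v w ≤ dk I m v w) → dbar I v w = dk I k v w := fun k h =>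
    le_antisymm (iInf_le _ k) (le_iInf h)
  rcases (hmin 0).eq_or_lt with h0 | h0
  · have hmin0 : ∀ m, dk I 0 v w ≤ dk I m v w := h0 ▸ hmin
    exact ⟨0, Nat.zero_le _, hbar 0 hmin0, hmin0, Or.inl rfl⟩
  · refine ⟨k, Nat.lt_succ_iff.1 (Finset.mem_range.1 hkK), hbar k hmin, hmin, ?_⟩
    cases k with
    | zero => exact Or.inl rfl
    | succ m =>
      refine Or.inr ⟨m, rfl, ?_⟩
      refine sInf_chainCosts_mem (R := dist v w) (locallyFinite_of_separated hδ hsep) hcpt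
        dist_nonneg ?_
      rw [← edist_dist]
      exact h0
end
end

section
/- Let p ∈ ℝ^N \ S and let 0 < r ≤ dist(p, S). Then the open d̄-ball of radius r about p coincides with the Euclidean ball: {v ∈ ℝ^N : d̄(p, v) < r} = {v ∈ ℝ^N : |p − v| < r}. -/
open scoped ENNReal NNReal
open Metric Set Filter MeasureTheory

noncomputable section

/-- Every chain through at least one stitch costs at least the distance to the smocking set. -/
theorem ofReal_infDist_le_dk_succ {N : ℕ} {J : Type*} (I : J → Set (E N)) (m : ℕ) (p v : E N) :
    ENNReal.ofReal (Metric.infDist p (⋃ j, I j)) ≤ dk I (m + 1) p v := by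
  refine le_sInf ?_
  rintro c ⟨j, z, z', hz, -, -, rfl⟩
  have h : Metric.infDist p (⋃ j, I j) ≤ dist p (z 0) :=
    Metric.infDist_le_dist_of_mem (mem_iUnion.2 ⟨j 0, hz 0⟩)
  calc ENNReal.ofReal (Metric.infDist p (⋃ j, I j))
      ≤ edist p (z 0) := by rw [edist_dist]; exact ENNReal.ofReal_le_ofReal h
    _ ≤ _ := le_self_add.trans le_self_add

/-- for `p` off the smocking set and `0 < r ≤ dist(p, S)`, the open
`dbar`-ball of radius `r` about `p` coincides with the Euclidean ball. -/
theorem smocking_ball_eq_euclidean_ball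
    {N : ℕ} (hN : 1 ≤ N) {J : Type} [Countable J] (I : J → Set (E N))
    (hne : ∀ j, (I j).Nonempty) (hcpt : ∀ j, IsCompact (I j))
    (hconn : ∀ j, IsConnected (I j))
    (hdisj : Pairwise fun j j' => Disjoint (I j) (I j'))
    (hsep : ∃ δ : ℝ, 0 < δ ∧ ∀ j j', j ≠ j' → ∀ z ∈ I j, ∀ z' ∈ I j', δ ≤ dist z z')
    (p : E N) (hp : p ∉ ⋃ j, I j)
    (r : ℝ) (hr : 0 < r) (hrS : r ≤ Metric.infDist p (⋃ j, I j)) :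
    {v : E N | dbar I p v < ENNReal.ofReal r} = {v : E N | dist p v < r} := by
  ext v
  have hv : edist p v < ENNReal.ofReal r ↔ dist p v < r := by
    rw [edist_dist, ENNReal.ofReal_lt_ofReal_iff hr]
  rw [mem_ofPred_eq, mem_ofPred_eq, ← hv, dbar, iInf_lt_iff]
  refine ⟨?_, fun h => ⟨0, h⟩⟩
  rintro ⟨_ | m, hk⟩
  · exact hk
  · exact absurd hk (not_lt.2 ((ENNReal.ofReal_le_ofReal hrS).trans
      (ofReal_infDist_le_dk_succ I m p v)))
end
end

section
/- Let j ∈ J, let z ∈ I_j and let 0 < r < δ, where δ is the smocking separation factor. Then the open d̄-ball of radius r about z coincides with the open r-tubular neighborhood of the stitch I_j: {v ∈ ℝ^N : d̄(z, v) < r} = {v ∈ ℝ^N : dist(v, I_j) < r}. -/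
open scoped ENNReal NNReal
open Metric Set Filter MeasureTheory

noncomputable section

/-- Jumping through a single stitch: a point `v` is at `dbar`-distance at most `edist y v` from
`z` when `z` and `y` lie in the same stitch. -/
theorem dbar_le_edist_of_mem {N : ℕ} {J : Type*} (I : J → Set (E N)) {j : J} {z y : E N}
    (hz : z ∈ I j) (hy : y ∈ I j) (v : E N) : dbar I z v ≤ edist y v :=
  (iInf_le (fun k => dk I k z v) 1).trans <| sInf_le (a := edist y v)
    ⟨fun _ => j, fun _ => z, fun _ => y, fun _ => hz, fun _ => hy, fun i => i.elim0, by simp⟩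

/-- A chain starting in the stitch `I j` and cheaper than the separation factor never leaves
that stitch. -/
theorem exists_mem_edist_le_of_mem_chainCosts {N : ℕ} {J : Type*} {I : J → Set (E N)} {δ : ℝ}
    (hsep : ∀ j j', j ≠ j' → ∀ z ∈ I j, ∀ z' ∈ I j', δ ≤ dist z z')
    {j : J} {z v : E N} (hz : z ∈ I j) {m : ℕ} {c : ℝ≥0∞} (hc : c ∈ chainCosts I m z v)
    (hcδ : c < ENNReal.ofReal δ) : ∃ y ∈ I j, edist y v ≤ c := by
  have hsep' : ∀ j j', j ≠ j' → ∀ z ∈ I j, ∀ z' ∈ I j', ENNReal.ofReal δ ≤ edist z z' := by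
    intro j j' hjj' z hz z' hz'
    rw [edist_dist]
    exact ENNReal.ofReal_le_ofReal (hsep j j' hjj' z hz z' hz')
  obtain ⟨k, x, x', hx, hx', hk, rfl⟩ := hc
  have hj : j = k 0 := by
    by_contra hne
    refine hcδ.not_ge ((hsep' j (k 0) hne z hz (x 0) (hx 0)).trans ?_)
    rw [add_assoc]
    exact le_self_add
  cases m with
  | zero => exact ⟨x' (Fin.last 0), hj ▸ hx' (Fin.last 0), le_add_self⟩
  | succ m =>
    refine absurd hcδ (not_lt.mpr ?_)
    calc ENNReal.ofReal δ
        ≤ edist (x' (Fin.castSucc 0)) (x (Fin.succ 0)) := hsep' _ _ (hk 0) _ (hx' _) _ (hx _)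
      _ ≤ ∑ i : Fin (m + 1), edist (x' i.castSucc) (x i.succ) :=
          Finset.single_le_sum (f := fun i : Fin (m + 1) => edist (x' i.castSucc) (x i.succ))
            (fun _ _ => zero_le) (Finset.mem_univ 0)
      _ ≤ _ := le_add_self.trans le_self_add

/-- for `z` in the stitch `I j` and `0 < r < δ`, the open `dbar`-ball of
radius `r` about `z` coincides with the open `r`-tubular neighborhood of `I j`. -/
theorem smocking_ball_eq_tubular_neighborhood
    {N : ℕ} (hN : 1 ≤ N) {J : Type} [Countable J] (I : J → Set (E N))
    (hne : ∀ j, (I j).Nonempty) (hcpt : ∀ j, IsCompact (I j))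
    (hconn : ∀ j, IsConnected (I j))
    (hdisj : Pairwise fun j j' => Disjoint (I j) (I j'))
    (δ : ℝ) (hδ : 0 < δ)
    (hsep : ∀ j j', j ≠ j' → ∀ z ∈ I j, ∀ z' ∈ I j', δ ≤ dist z z')
    (j : J) (z : E N) (hz : z ∈ I j) (r : ℝ) (hr : 0 < r) (hrδ : r < δ) :
    {v : E N | dbar I z v < ENNReal.ofReal r}
      = {v : E N | Metric.infDist v (I j) < r} := by
  ext v
  simp only [mem_ofPred_eq, infDist_lt_iff (hne j)]
  constructor
  · intro h
    obtain ⟨k, hk⟩ := iInf_lt_iff.mp h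
    suffices ∃ y ∈ I j, edist y v < ENNReal.ofReal r by
      obtain ⟨y, hy, hyv⟩ := this
      exact ⟨y, hy, by rwa [dist_comm, ← edist_lt_ofReal]⟩
    cases k with
    | zero => exact ⟨z, hz, hk⟩
    | succ m =>
      obtain ⟨c, hc, hcr⟩ := sInf_lt_iff.mp hk
      obtain ⟨y, hy, hyc⟩ := exists_mem_edist_le_of_mem_chainCosts hsep hz hc
        (hcr.trans_le (ENNReal.ofReal_le_ofReal hrδ.le))
      exact ⟨y, hy, hyc.trans_lt hcr⟩
  · rintro ⟨y, hy, hyv⟩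
    exact (dbar_le_edist_of_mem I hz hy v).trans_lt (edist_lt_ofReal.mpr (dist_comm v y ▸ hyv))
end
end

section
/- For every x₀ ∈ ℝ^N and every R ≥ 0, the sublevel set U_R(x₀) := {v ∈ ℝ^N : d̄(x₀, v) ≤ R} is a compact subset of ℝ^N; in particular its Lebesgue measure is finite. Equivalently, the 1-Lipschitz function v ↦ d̄(x₀, v) is proper. -/
open scoped ENNReal NNReal
open Metric Set Filter MeasureTheory

noncomputable section

/-- Only finitely many members of a uniformly separated family meet a bounded set. -/
theorem finite_setOf_inter_nonempty_of_separated {X J : Type*} [PseudoMetricSpace X]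
    [ProperSpace X] (I : J → Set X) {δ : ℝ} (hδ : 0 < δ)
    (hsep : ∀ j j', j ≠ j' → ∀ z ∈ I j, ∀ z' ∈ I j', δ ≤ dist z z')
    {S : Set X} (hS : Bornology.IsBounded S) :
    {j | (I j ∩ S).Nonempty}.Finite := by
  obtain ⟨t, ht, hSt⟩ := Metric.totallyBounded_iff.1
    (hS.isCompact_closure.totallyBounded.subset subset_closure) (δ / 2) (by positivity)
  have key : ∀ j : {j | (I j ∩ S).Nonempty}, ∃ y ∈ t, ∃ p ∈ I j, dist p y < δ / 2 := by
    rintro ⟨j, p, hpI, hpS⟩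
    obtain ⟨y, hy, hpy⟩ := mem_iUnion₂.1 (hSt hpS)
    exact ⟨y, hy, p, hpI, hpy⟩
  choose y hyt p hp hpy using key
  have := ht.to_subtype
  refine Set.finite_coe_iff.1 (Finite.of_injective (fun j => (⟨y j, hyt j⟩ : t)) ?_)
  intro j j' hjj'
  by_contra hne
  have h1 := hsep j j' (Subtype.coe_ne_coe.2 hne) _ (hp j) _ (hp j')
  have h2 := dist_triangle_right (p j) (p j') (y j)
  have h3 := hpy j
  have h4 := hpy j'
  rw [← show y j = y j' from Subtype.ext_iff.1 hjj'] at h4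
  linarith

/-- The points within distance `r` of `S` or of a stitch meeting `S`. -/
def reachStep {N : ℕ} {J : Type*} (I : J → Set (E N)) (r : ℝ) (S : Set (E N)) : Set (E N) :=
  cthickening r (S ∪ ⋃ j ∈ {j | (I j ∩ S).Nonempty}, I j)

/-- The points reached from `closedBall x r` by `n` successive applications of `reachStep`. -/
def reach {N : ℕ} {J : Type*} (I : J → Set (E N)) (r : ℝ) (x : E N) (n : ℕ) : Set (E N) :=
  (reachStep I r)^[n] (closedBall x r)

theorem reach_succ {N : ℕ} {J : Type*} (I : J → Set (E N)) (r : ℝ) (x : E N) (n : ℕ) :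
    reach I r x (n + 1) = reachStep I r (reach I r x n) :=
  Function.iterate_succ_apply' _ _ _

theorem mem_reachStep {N : ℕ} {J : Type*} {I : J → Set (E N)} {r : ℝ} {S : Set (E N)}
    {j : J} {z z' w : E N} (hzS : z ∈ S) (hz : z ∈ I j) (hz' : z' ∈ I j)
    (hw : dist z' w ≤ r) : w ∈ reachStep I r S :=
  mem_cthickening_of_dist_le w z' r _
    (Or.inr (mem_biUnion (show j ∈ {j | (I j ∩ S).Nonempty} from ⟨z, hz, hzS⟩) hz'))
    (by rwa [dist_comm])

theorem isBounded_reach {N : ℕ} {J : Type*} (I : J → Set (E N))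
    (hbdd : ∀ j, Bornology.IsBounded (I j)) {δ : ℝ} (hδ : 0 < δ)
    (hsep : ∀ j j', j ≠ j' → ∀ z ∈ I j, ∀ z' ∈ I j', δ ≤ dist z z')
    (r : ℝ) (x : E N) (n : ℕ) : Bornology.IsBounded (reach I r x n) := by
  induction n with
  | zero => exact isBounded_closedBall
  | succ n ih =>
    rw [reach_succ]
    refine Bornology.IsBounded.cthickening (ih.union ?_)
    exact (Bornology.isBounded_biUnion
      (finite_setOf_inter_nonempty_of_separated I hδ hsep ih)).2 fun j _ => hbdd j

theorem dbar_ne_top {N : ℕ} {J : Type*} (I : J → Set (E N)) (v w : E N) :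
    dbar I v w ≠ ⊤ :=
  ne_top_of_le_ne_top (edist_ne_top v w) (dbar_le_edist I v w)

theorem dbar_le_dbar_add_edist {N : ℕ} {J : Type*} (I : J → Set (E N)) (x v w : E N) :
    dbar I x w ≤ dbar I x v + edist v w := by
  rw [dbar, dbar, ENNReal.iInf_add]
  refine iInf_mono fun k => ?_
  cases k with
  | zero => exact edist_triangle _ _ _
  | succ m =>
    simp only [dk]
    rw [sInf_eq_iInf (s := chainCosts I m x v), ENNReal.iInf_add]
    refine le_iInf fun c => ?_
    rw [ENNReal.iInf_add]
    refine le_iInf ?_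
    rintro ⟨j, z, z', hz, hz', hj, rfl⟩
    refine (sInf_le (show _ ∈ chainCosts I m x w from
      ⟨j, z, z', hz, hz', hj, rfl⟩)).trans ?_
    rw [add_assoc (_ + _)]
    gcongr
    exact edist_triangle _ _ _

theorem lipschitzWith_dbar_toReal {N : ℕ} {J : Type*} (I : J → Set (E N)) (x : E N) :
    LipschitzWith 1 fun v => (dbar I x v).toReal := by
  refine LipschitzWith.of_le_add fun v w => ?_
  rw [dist_edist, ← ENNReal.toReal_add (dbar_ne_top I x w) (edist_ne_top v w)]
  refine ENNReal.toReal_mono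
    (ENNReal.add_ne_top.2 ⟨dbar_ne_top I x w, edist_ne_top v w⟩) ?_
  rw [edist_comm]
  exact dbar_le_dbar_add_edist I x w v

/-- The end of a chain of cost at most `r` through `m + 1` stitches lies in the corresponding
reachable set, and `m` is controlled by the separation. -/
theorem mem_reach_of_mem_chainCosts {N : ℕ} {J : Type*} {I : J → Set (E N)} {δ : ℝ}
    (hsep : ∀ j j', j ≠ j' → ∀ z ∈ I j, ∀ z' ∈ I j', δ ≤ dist z z')
    {r : ℝ} (hr : 0 ≤ r) {x v : E N} {m : ℕ} {c : ℝ≥0∞}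
    (hc : c ∈ chainCosts I m x v) (hcr : c ≤ ENNReal.ofReal r) :
    v ∈ reach I r x (m + 1) ∧ m * δ ≤ r := by
  obtain ⟨j, z, z', hz, hz', hj, rfl⟩ := hc
  have hsum : dist x (z 0) + (∑ i : Fin m, dist (z' i.castSucc) (z i.succ)) +
      dist (z' (Fin.last m)) v ≤ r := by
    rw [← ENNReal.ofReal_le_ofReal_iff hr, ENNReal.ofReal_add (by positivity) dist_nonneg,
      ENNReal.ofReal_add dist_nonneg (by positivity),
      ENNReal.ofReal_sum_of_nonneg fun _ _ => dist_nonneg]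
    simpa only [edist_dist] using hcr
  have hsum0 : 0 ≤ ∑ i : Fin m, dist (z' i.castSucc) (z i.succ) := by positivity
  have h0 : 0 ≤ dist x (z 0) := dist_nonneg
  have hl : 0 ≤ dist (z' (Fin.last m)) v := dist_nonneg
  have hjump : ∀ i : Fin m, dist (z' i.castSucc) (z i.succ) ≤ r := fun i =>
    (Finset.single_le_sum (f := fun i : Fin m => dist (z' i.castSucc) (z i.succ))
      (fun _ _ => dist_nonneg) (Finset.mem_univ i)).trans (by linarith)
  have hmem : ∀ i : Fin (m + 1), z i ∈ reach I r x i := by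
    intro i
    induction i using Fin.induction with
    | zero =>
      show z 0 ∈ closedBall x r
      rw [mem_closedBall, dist_comm]
      linarith
    | succ i ih =>
      rw [Fin.val_succ, reach_succ]
      exact mem_reachStep ih (hz _) (hz' _) (hjump i)
  constructor
  · rw [reach_succ]
    exact mem_reachStep (hmem (Fin.last m)) (hz _) (hz' _) (by linarith)
  · have := Finset.card_nsmul_le_sum Finset.univ
      (fun i : Fin m => dist (z' i.castSucc) (z i.succ)) δ
      fun i _ => hsep _ _ (hj i) _ (hz' _) _ (hz _)
    rw [Finset.card_univ, Fintype.card_fin, nsmul_eq_mul] at this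
    linarith

theorem isBounded_setOf_dbar_le {N : ℕ} {J : Type*} (I : J → Set (E N))
    (hbdd : ∀ j, Bornology.IsBounded (I j)) {δ : ℝ} (hδ : 0 < δ)
    (hsep : ∀ j j', j ≠ j' → ∀ z ∈ I j, ∀ z' ∈ I j', δ ≤ dist z z')
    (x : E N) {R : ℝ} (hR : 0 ≤ R) :
    Bornology.IsBounded {v | dbar I x v ≤ ENNReal.ofReal R} := by
  have hR1 : 0 ≤ R + 1 := by linarith
  refine ((Bornology.isBounded_biUnion (Set.finite_Iic (⌈(R + 1) / δ⌉₊ + 1))).2 fun n _ =>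
    isBounded_reach I hbdd hδ hsep (R + 1) x n).subset fun v hv => ?_
  have hlt : dbar I x v < ENNReal.ofReal (R + 1) :=
    lt_of_le_of_lt hv ((ENNReal.ofReal_lt_ofReal_iff (by linarith)).2 (by linarith))
  obtain ⟨k, hk⟩ := iInf_lt_iff.1 hlt
  cases k with
  | zero =>
    refine mem_biUnion (x := 0) (Nat.zero_le _) ?_
    show v ∈ closedBall x (R + 1)
    rw [mem_closedBall, dist_comm, ← ENNReal.ofReal_le_ofReal_iff hR1, ← edist_dist]
    exact hk.le
  | succ m =>
    obtain ⟨c, hc, hcr⟩ := sInf_lt_iff.1 hk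
    obtain ⟨hv', hm⟩ := mem_reach_of_mem_chainCosts hsep hR1 hc hcr.le
    refine mem_biUnion (x := m + 1) (Nat.succ_le_succ ?_) hv'
    exact_mod_cast ((le_div_iff₀ hδ).2 hm).trans (Nat.le_ceil _)

/-- sublevel sets of `v ↦ dbar x₀ v` are compact with finite Lebesgue
measure; equivalently, this 1-Lipschitz function is proper. -/
theorem smocking_sublevel_compact
    {N : ℕ} (hN : 1 ≤ N) {J : Type} [Countable J] (I : J → Set (E N))
    (hne : ∀ j, (I j).Nonempty) (hcpt : ∀ j, IsCompact (I j))
    (hconn : ∀ j, IsConnected (I j))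
    (hdisj : Pairwise fun j j' => Disjoint (I j) (I j'))
    (hsep : ∃ δ : ℝ, 0 < δ ∧ ∀ j j', j ≠ j' → ∀ z ∈ I j, ∀ z' ∈ I j', δ ≤ dist z z') :
    ∀ (x₀ : E N) (R : ℝ), 0 ≤ R →
      IsCompact {v : E N | dbar I x₀ v ≤ ENNReal.ofReal R} ∧
      MeasureTheory.volume {v : E N | dbar I x₀ v ≤ ENNReal.ofReal R} < ⊤ ∧
      IsProperMap (fun v : E N => (dbar I x₀ v).toReal) := by
  obtain ⟨δ, hδ, hsep⟩ := hsep
  have hcont (x : E N) := (lipschitzWith_dbar_toReal I x).continuous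
  have hset (x : E N) {R : ℝ} (hR : 0 ≤ R) : {v : E N | dbar I x v ≤ ENNReal.ofReal R} =
      (fun v => (dbar I x v).toReal) ⁻¹' Iic R :=
    Set.ext fun v => ENNReal.le_ofReal_iff_toReal_le (dbar_ne_top I x v) hR
  have hcompact (x : E N) {R : ℝ} (hR : 0 ≤ R) :
      IsCompact {v : E N | dbar I x v ≤ ENNReal.ofReal R} :=
    isCompact_of_isClosed_isBounded (hset x hR ▸ isClosed_Iic.preimage (hcont x))
      (isBounded_setOf_dbar_le I (fun j => (hcpt j).isBounded) hδ hsep x hR)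
  refine fun x R hR => ⟨hcompact x hR, (hcompact x hR).measure_lt_top, ?_⟩
  refine isProperMap_iff_isCompact_preimage.2 ⟨hcont x, fun K hK => ?_⟩
  obtain ⟨b, hb⟩ := hK.bddAbove
  refine (hcompact x (le_max_right b 0)).of_isClosed_subset (hK.isClosed.preimage (hcont x)) ?_
  rw [hset x (le_max_right b 0)]
  exact preimage_mono fun y hy => (hb hy).trans (le_max_left b 0)
end
end

section
/- Suppose the smocking set S is nice, i.e. for every compact set K ⊆ ℝ^N one has lim_{ε→0⁺} vol(T_ε(S) ∩ K) = 0. Then for every x₀ ∈ ℝ^N, lim_{ε→0⁺} vol({v ∈ ℝ^N : d̄(x₀, v) ≤ ε}) = 0. -/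
open scoped ENNReal NNReal
open Metric Set Filter MeasureTheory

noncomputable section

/-- A point whose smocking distance from `v` is less than `r`, with `r` at most the separation
factor, is reached from `v` through at most one stitch. -/
theorem dist_lt_or_exists_of_dbar_lt {N : ℕ} {J : Type*} {I : J → Set (E N)} {δ r : ℝ}
    (hsep : ∀ j j', j ≠ j' → ∀ z ∈ I j, ∀ z' ∈ I j', δ ≤ dist z z') (hr : r ≤ δ)
    {v w : E N} (h : dbar I v w < ENNReal.ofReal r) :
    dist v w < r ∨ ∃ j, ∃ z ∈ I j, ∃ z' ∈ I j, dist v z < r ∧ dist z' w < r := by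
  obtain ⟨k, hk⟩ := iInf_lt_iff.mp h
  rcases k with _ | m
  · left
    rwa [dk, edist_lt_ofReal] at hk
  · right
    obtain ⟨c, ⟨j, z, z', hz, hz', hj, rfl⟩, hc⟩ := sInf_lt_iff.mp hk
    rcases m with _ | m
    · refine ⟨j 0, z 0, hz 0, z' 0, hz' 0, ?_, ?_⟩ <;> rw [← edist_lt_ofReal]
      · exact (le_self_add.trans le_self_add).trans_lt hc
      · exact le_add_self.trans_lt hc
    · have h₁ := (Finset.single_le_sum
        (f := fun i : Fin (m + 1) => edist (z' i.castSucc) (z i.succ))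
        (fun _ _ => zero_le) (Finset.mem_univ 0)).trans
          (le_add_self.trans le_self_add) |>.trans_lt hc
      rw [edist_lt_ofReal] at h₁
      linarith [hsep _ _ (hj 0) _ (hz' _) _ (hz _)]

/-- The stitches that meet a ball of radius at most half the separation factor have bounded
union. -/
theorem isBounded_biUnion_stitches_meeting_ball {N : ℕ} {J : Type*} {I : J → Set (E N)} {δ r : ℝ}
    (hcpt : ∀ j, IsCompact (I j))
    (hsep : ∀ j j', j ≠ j' → ∀ z ∈ I j, ∀ z' ∈ I j', δ ≤ dist z z') (hr : r ≤ δ / 2)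
    (x : E N) :
    Bornology.IsBounded (⋃ j ∈ {j | (I j ∩ ball x r).Nonempty}, I j) := by
  have hsub : {j | (I j ∩ ball x r).Nonempty}.Subsingleton := by
    rintro j ⟨z, hz, hzx⟩ j' ⟨z', hz', hzx'⟩
    by_contra hjj
    have h₁ := hsep j j' hjj z hz z' hz'
    have h₂ := dist_triangle_right z z' x
    rw [mem_ball] at hzx hzx'
    linarith
  exact (Bornology.isBounded_biUnion hsub.finite).mpr fun j _ => (hcpt j).isBounded

theorem tendsto_volume_closedBall_two_mul {N : ℕ} (hN : 1 ≤ N) (x : E N) :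
    Tendsto (fun ε : ℝ => volume (closedBall x (2 * ε))) (nhdsWithin 0 (Ioi 0)) (nhds 0) := by
  have : Nonempty (Fin N) := ⟨⟨0, hN⟩⟩
  have hmul : Tendsto (fun ε : ℝ => 2 * ε) (nhdsWithin 0 (Ioi 0)) (nhds 0) :=
    ((continuous_const_mul (2 : ℝ)).tendsto' 0 0 (mul_zero 2)).mono_left nhdsWithin_le_nhds
  have h := (tendsto_measure_cthickening_of_isCompact (μ := volume)
    (isCompact_singleton (x := x))).comp hmul
  rw [measure_singleton] at h
  refine h.congr' ?_
  filter_upwards [self_mem_nhdsWithin] with ε hε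
  simp only [Function.comp_apply]
  rw [cthickening_singleton x (mul_nonneg zero_le_two (le_of_lt hε))]

/-- if the smocking set is nice then the volume of small closed
`dbar`-balls tends to zero. -/
theorem nice_smocking_small_ball_volume
    {N : ℕ} (hN : 1 ≤ N) {J : Type} [Countable J] (I : J → Set (E N))
    (hne : ∀ j, (I j).Nonempty) (hcpt : ∀ j, IsCompact (I j))
    (hconn : ∀ j, IsConnected (I j))
    (hdisj : Pairwise fun j j' => Disjoint (I j) (I j'))
    (hsep : ∃ δ : ℝ, 0 < δ ∧ ∀ j j', j ≠ j' → ∀ z ∈ I j, ∀ z' ∈ I j', δ ≤ dist z z')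
    (hnice : ∀ K : Set (E N), IsCompact K →
      Filter.Tendsto
        (fun ε : ℝ =>
          MeasureTheory.volume ({x : E N | Metric.infDist x (⋃ j, I j) < ε} ∩ K))
        (nhdsWithin 0 (Set.Ioi 0)) (nhds 0)) :
    ∀ x₀ : E N,
      Filter.Tendsto
        (fun ε : ℝ => MeasureTheory.volume {v : E N | dbar I x₀ v ≤ ENNReal.ofReal ε})
        (nhdsWithin 0 (Set.Ioi 0)) (nhds 0) := by
  intro x₀
  obtain ⟨δ, hδ, hsep⟩ := hsep
  set B : Set (E N) := ⋃ j ∈ {j | (I j ∩ ball x₀ (δ / 2)).Nonempty}, I j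
  have hBb : Bornology.IsBounded B :=
    isBounded_biUnion_stitches_meeting_ball hcpt hsep le_rfl x₀
  have hmul : Tendsto (fun ε : ℝ => 2 * ε) (nhdsWithin 0 (Ioi 0)) (nhdsWithin 0 (Ioi 0)) := by
    refine tendsto_nhdsWithin_iff.mpr ⟨?_, ?_⟩
    · exact ((continuous_const_mul (2 : ℝ)).tendsto' 0 0 (mul_zero 2)).mono_left
        nhdsWithin_le_nhds
    · filter_upwards [self_mem_nhdsWithin] with ε hε
      exact mul_pos two_pos (mem_Ioi.mp hε)
  have hlim := (tendsto_volume_closedBall_two_mul hN x₀).add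
    ((hnice (cthickening 1 B)
      (isCompact_of_isClosed_isBounded isClosed_cthickening hBb.cthickening)).comp hmul)
  rw [add_zero] at hlim
  refine tendsto_of_tendsto_of_tendsto_of_le_of_le' tendsto_const_nhds hlim
    (Eventually.of_forall fun _ => zero_le) ?_
  filter_upwards [Ioo_mem_nhdsGT (show (0 : ℝ) < min (δ / 4) (1 / 2) by positivity)] with ε hε
  obtain ⟨hε₀, hε₁⟩ := hε
  obtain ⟨hεδ, hε_half⟩ := lt_min_iff.mp hε₁
  refine (measure_mono ?_).trans (measure_union_le _ _)
  intro v hv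
  have hlt : dbar I x₀ v < ENNReal.ofReal (2 * ε) :=
    lt_of_le_of_lt hv ((ENNReal.ofReal_lt_ofReal_iff (by linarith)).mpr (by linarith))
  rcases dist_lt_or_exists_of_dbar_lt hsep (by linarith) hlt with h | ⟨j, z, hz, z', hz', h, h'⟩
  · left
    rw [mem_closedBall, dist_comm]
    exact h.le
  · right
    rw [dist_comm] at h h'
    refine ⟨(infDist_le_dist_of_mem (mem_iUnion_of_mem j hz')).trans_lt h', ?_⟩
    refine mem_cthickening_of_dist_le v z' 1 B ?_ (by linarith)
    exact mem_biUnion (show j ∈ {j | (I j ∩ ball x₀ (δ / 2)).Nonempty} from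
      ⟨z, hz, mem_ball.mpr (by linarith)⟩) hz'
end
end

section
/- Let p₀ ∈ ℝ^N, R > 0, set U := {v ∈ ℝ^N : d̄(p₀, v) ≤ R}, and let D := diam(U) be its (finite) Euclidean diameter. Let r > 0 and let p, q ∈ U satisfy dist(p, S) ≥ r and dist(q, S) ≥ r. Then d̄(p, q) ≤ |p − q| and min(r, D) · |p − q| ≤ D · d̄(p, q). In particular, the restriction of the quotient map to U minus the r-tubular neighborhood of S is bi-Lipschitz, with d̄(p,q)/|p−q| ∈ [min(r/D, 1), 1] for p ≠ q. -/
open scoped ENNReal NNReal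
open Metric Set Filter MeasureTheory

noncomputable section

/-- A chain either goes straight from `v` to `w` or has to reach the smocking set first. -/
theorem min_edist_infEDist_le_dbar {N : ℕ} {J : Type*} (I : J → Set (E N)) (v w : E N) :
    min (edist v w) (Metric.infEDist v (⋃ j, I j)) ≤ dbar I v w := by
  refine le_iInf fun k => ?_
  cases k with
  | zero => exact min_le_left _ _
  | succ m =>
    refine (min_le_right _ _).trans (le_sInf ?_)
    rintro c ⟨j, z, z', hz, -, -, rfl⟩
    calc Metric.infEDist v (⋃ j, I j) ≤ edist v (z 0) :=
          Metric.infEDist_le_edist_of_mem (mem_iUnion_of_mem _ (hz 0))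
      _ ≤ _ := by rw [add_assoc]; exact le_self_add

/-- bi-Lipschitz bounds for the smocking pseudometric away from the
smocking set, on a closed `dbar`-ball `U` of Euclidean diameter `D`. -/
theorem smocking_biLipschitz_away_from_stitches
    {N : ℕ} (hN : 1 ≤ N) {J : Type} [Countable J] (I : J → Set (E N))
    (hne : ∀ j, (I j).Nonempty) (hcpt : ∀ j, IsCompact (I j))
    (hconn : ∀ j, IsConnected (I j))
    (hdisj : Pairwise fun j j' => Disjoint (I j) (I j'))
    (hsep : ∃ δ : ℝ, 0 < δ ∧ ∀ j j', j ≠ j' → ∀ z ∈ I j, ∀ z' ∈ I j', δ ≤ dist z z')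
    (p₀ : E N) (R : ℝ) (hR : 0 < R) (r : ℝ) (hr : 0 < r) (p q : E N)
    (hpU : dbar I p₀ p ≤ ENNReal.ofReal R) (hqU : dbar I p₀ q ≤ ENNReal.ofReal R)
    (hpS : r ≤ Metric.infDist p (⋃ j, I j)) (hqS : r ≤ Metric.infDist q (⋃ j, I j)) :
    (dbar I p q).toReal ≤ dist p q ∧
    min r (Metric.diam {v : E N | dbar I p₀ v ≤ ENNReal.ofReal R}) * dist p q
      ≤ Metric.diam {v : E N | dbar I p₀ v ≤ ENNReal.ofReal R}
          * (dbar I p q).toReal := by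
  have hle := dbar_le_edist I p q
  have hreal : (dbar I p q).toReal ≤ dist p q := by
    rw [dist_edist]
    exact ENNReal.toReal_mono (edist_ne_top p q) hle
  refine ⟨hreal, ?_⟩
  set U := {v : E N | dbar I p₀ v ≤ ENNReal.ofReal R}
  by_cases hb : Bornology.IsBounded U
  · have hD : dist p q ≤ Metric.diam U := Metric.dist_le_diam_of_mem hb hpU hqU
    have hinf : ENNReal.ofReal r ≤ Metric.infEDist p (⋃ j, I j) :=
      ENNReal.ofReal_le_of_le_toReal hpS
    have hlow : min (dist p q) r ≤ (dbar I p q).toReal := by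
      rw [← ENNReal.ofReal_le_iff_le_toReal (ne_top_of_le_ne_top (edist_ne_top p q) hle),
        ENNReal.ofReal_min, ← edist_dist]
      exact (min_le_min_left _ hinf).trans (min_edist_infEDist_le_dbar I p q)
    refine le_trans ?_ (mul_le_mul_of_nonneg_left hlow Metric.diam_nonneg)
    rcases min_cases (dist p q) r with ⟨h, -⟩ | ⟨h, -⟩ <;> rw [h]
    · exact mul_le_mul_of_nonneg_right (min_le_right _ _) dist_nonneg
    · rw [mul_comm (Metric.diam U)]
      exact mul_le_mul (min_le_left _ _) hD dist_nonneg hr.le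
  · simp [Metric.diam_eq_zero_of_unbounded hb, hr.le]
end
end

section
/- Suppose F is a norm on ℝ^N and K ≥ 0 is a constant such that |d̄(x, x') − F(x − x')| ≤ K for all x, x' ∈ ℝ^N. Let (X, d_X) be the metric space obtained from the pseudometric space (ℝ^N, d̄) by identifying points at d̄-distance zero, with quotient map π : ℝ^N → X, and fix p₀ ∈ ℝ^N, x₀ := π(p₀). Fix r > 0. For R > 0, the closed ball B̄(x₀, Rr) in X, equipped with the rescaled metric d_X/R, is a nonempty compact metric space, and its Gromov–Hausdorff distance to the closed ball {v ∈ ℝ^N : F(v) ≤ r} equipped with the norm metric d_F(u, v) := F(u − v) tends to 0 as R → ∞. In particular (X, d_X) has a unique Gromov–Hausdorff tangent cone at infinity, namely (ℝ^N, d_F). -/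
open scoped ENNReal NNReal
open Metric Set Filter MeasureTheory

noncomputable section

theorem Seminorm.continuous_of_finiteDimensional {V : Type*} [NormedAddCommGroup V]
    [NormedSpace ℝ V] [FiniteDimensional ℝ V] (p : Seminorm ℝ V) : Continuous p :=
  continuousOn_univ.1 (p.convexOn.continuousOn isOpen_univ)

/-- A definite seminorm on a finite-dimensional space dominates the given norm. -/
theorem Seminorm.exists_pos_mul_norm_le {V : Type*} [NormedAddCommGroup V]
    [NormedSpace ℝ V] [FiniteDimensional ℝ V] (p : Seminorm ℝ V) (hp : ∀ v, p v = 0 → v = 0) :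
    ∃ c : ℝ, 0 < c ∧ ∀ v, c * ‖v‖ ≤ p v := by
  have : ProperSpace V := FiniteDimensional.proper ℝ V
  rcases (sphere (0 : V) 1).eq_empty_or_nonempty with hs | hs
  · refine ⟨1, one_pos, fun v => ?_⟩
    by_cases hv : v = 0
    · simp [hv]
    · have : ‖v‖⁻¹ • v ∈ sphere (0 : V) 1 := by simp [norm_smul, hv]
      simp [hs] at this
  · obtain ⟨u, hu, hmin⟩ := (isCompact_sphere (0 : V) 1).exists_isMinOn hs
      p.continuous_of_finiteDimensional.continuousOn
    have hu0 : u ≠ 0 := ne_zero_of_mem_unit_sphere ⟨u, hu⟩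
    refine ⟨p u, (apply_nonneg p u).lt_of_ne fun h => hu0 (hp u h.symm), fun v => ?_⟩
    by_cases hv : v = 0
    · simp [hv]
    · have hmem : ‖v‖⁻¹ • v ∈ sphere (0 : V) 1 := by simp [norm_smul, hv]
      have h : p u ≤ p (‖v‖⁻¹ • v) := hmin hmem
      rw [map_smul_eq_mul, norm_inv, norm_norm, inv_mul_eq_div] at h
      exact (le_div_iff₀ (norm_pos_iff.2 hv)).1 h

/-- Scaling moves a point of the ball of radius `a + b` into the ball of radius `a`, over a
distance at most `b`. -/
theorem Seminorm.exists_le_sub_le {V : Type*} [AddCommGroup V] [Module ℝ V] (p : Seminorm ℝ V)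
    {a b : ℝ} (ha : 0 ≤ a) (hb : 0 ≤ b) {v : V} (hv : p v ≤ a + b) :
    ∃ w, p w ≤ a ∧ p (v - w) ≤ b := by
  rcases le_or_gt (p v) a with h | h
  · exact ⟨v, h, by simpa using hb⟩
  · have hpos : 0 < p v := ha.trans_lt h
    have hle : a / p v ≤ 1 := (div_le_one hpos).2 h.le
    refine ⟨(a / p v) • v, ?_, ?_⟩
    · rw [map_smul_eq_mul, Real.norm_of_nonneg (by positivity), div_mul_cancel₀ _ hpos.ne']
    · have : v - (a / p v) • v = (1 - a / p v) • v := by rw [sub_smul, one_smul]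
      rw [this, map_smul_eq_mul, Real.norm_of_nonneg (sub_nonneg.2 hle), sub_mul, one_mul,
        div_mul_cancel₀ _ hpos.ne']
      linarith

/-- The metric of a definite seminorm. -/
abbrev Seminorm.toMetricSpace {V : Type*} [AddCommGroup V] [Module ℝ V] (p : Seminorm ℝ V)
    (hp : ∀ v, p v = 0 → v = 0) : MetricSpace V where
  dist u v := p (u - v)
  dist_self u := by simp
  dist_comm u v := map_sub_rev p u v
  dist_triangle u v w := by simpa using map_add_le_add p (u - v) (v - w)
  eq_of_dist_eq_zero h := sub_eq_zero.1 (hp _ h)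

/-- The metric of `X` divided by `R`. -/
abbrev MetricSpace.divDist (X : Type*) [MetricSpace X] {R : ℝ} (hR : 0 < R) : MetricSpace X where
  dist x y := dist x y / R
  dist_self x := by simp
  dist_comm x y := by rw [dist_comm]
  dist_triangle x y z := by
    rw [← add_div]
    exact div_le_div_of_nonneg_right (dist_triangle x y z) hR.le
  eq_of_dist_eq_zero h := by simpa [hR.ne'] using h

/-- Two metric spaces embed in a common one so that points related by an approximately isometric
correspondence are close. -/
theorem exists_common_metricSpace {X Y ι : Type} [MetricSpace X] [MetricSpace Y] [Nonempty ι]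
    (Φ : ι → X) (Ψ : ι → Y) {ε : ℝ} (hε : 0 < ε)
    (H : ∀ i j, |dist (Φ i) (Φ j) - dist (Ψ i) (Ψ j)| ≤ 2 * ε) :
    ∃ (Z : Type) (_ : MetricSpace Z) (f : X → Z) (g : Y → Z),
      (∀ x y, dist (f x) (f y) = dist x y) ∧ (∀ x y, dist (g x) (g y) = dist x y) ∧
      ∀ i, dist (f (Φ i)) (g (Ψ i)) = ε :=
  ⟨X ⊕ Y, glueMetricApprox Φ Ψ ε hε H, Sum.inl, Sum.inr, fun _ _ => rfl, fun _ _ => rfl,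
    glueDist_glued_points Φ Ψ ε⟩

theorem toReal_dbar_le_dist {N : ℕ} {J : Type*} (I : J → Set (E N)) (v w : E N) :
    (dbar I v w).toReal ≤ dist v w := by
  rw [dist_edist]
  exact ENNReal.toReal_mono (edist_ne_top v w) (iInf_le (fun k => dk I k v w) 0)

/-- if the smocking pseudometric is uniformly close to a norm `F`, then
for every `r > 0` the closed balls `B̄(x₀, R r)` of the quotient metric space `X`,
rescaled by `R`, are nonempty compact metric spaces that converge in the
Gromov–Hausdorff sense (expressed via distance-preserving embeddings into a common
metric space) to the closed `F`-ball of radius `r` as `R → ∞`; this is the unique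
GH tangent cone at infinity. -/
theorem smocking_GH_tangent_cone_at_infinity
    {N : ℕ} (hN : 1 ≤ N) {J : Type} [Countable J] (I : J → Set (E N))
    (hne : ∀ j, (I j).Nonempty) (hcpt : ∀ j, IsCompact (I j))
    (hconn : ∀ j, IsConnected (I j))
    (hdisj : Pairwise fun j j' => Disjoint (I j) (I j'))
    (hsep : ∃ δ : ℝ, 0 < δ ∧ ∀ j j', j ≠ j' → ∀ z ∈ I j, ∀ z' ∈ I j', δ ≤ dist z z')
    (F : E N → ℝ)
    (hFadd : ∀ u v : E N, F (u + v) ≤ F u + F v)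
    (hFsmul : ∀ (a : ℝ) (v : E N), F (a • v) = |a| * F v)
    (hFdef : ∀ v : E N, F v = 0 → v = 0)
    (K : ℝ) (hK : 0 ≤ K)
    (hKd : ∀ x x' : E N, |(dbar I x x').toReal - F (x - x')| ≤ K)
    (X : Type) [MetricSpace X] (π : E N → X) (hπsurj : Function.Surjective π)
    (hπ : ∀ v w : E N, dist (π v) (π w) = (dbar I v w).toReal)
    (p₀ : E N) (r : ℝ) (hr : 0 < r) :
    (∀ R : ℝ, 0 < R →
      (Metric.closedBall (π p₀) (R * r)).Nonempty ∧
      IsCompact (Metric.closedBall (π p₀) (R * r))) ∧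
    ∀ ε : ℝ, 0 < ε → ∃ R₀ : ℝ, 0 < R₀ ∧ ∀ R : ℝ, R₀ ≤ R →
      ∃ (Z : Type) (_ : MetricSpace Z) (f : X → Z) (g : E N → Z),
        (∀ x ∈ Metric.closedBall (π p₀) (R * r),
          ∀ y ∈ Metric.closedBall (π p₀) (R * r),
            dist (f x) (f y) = dist x y / R) ∧
        (∀ u ∈ {v : E N | F v ≤ r}, ∀ v ∈ {v : E N | F v ≤ r},
          dist (g u) (g v) = F (u - v)) ∧
        Metric.hausdorffDist (f '' Metric.closedBall (π p₀) (R * r))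
          (g '' {v : E N | F v ≤ r}) ≤ ε := by
  set p : Seminorm ℝ (E N) := Seminorm.of F hFadd hFsmul
  have hp : ∀ v, p v = 0 → v = 0 := hFdef
  have hd : ∀ x y, |dist (π x) (π y) - p (x - y)| ≤ K := fun x y => by
    rw [hπ]
    exact hKd x y
  have hπc : Continuous π := (LipschitzWith.of_dist_le_mul (K := 1) fun v w => by
    simpa [hπ] using toReal_dbar_le_dist I v w).continuous
  constructor
  · intro R hR
    refine ⟨⟨π p₀, mem_closedBall_self (by positivity)⟩, ?_⟩
    obtain ⟨c, hc, hcp⟩ := p.exists_pos_mul_norm_le hp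
    rw [← image_preimage_eq (closedBall (π p₀) (R * r)) hπsurj]
    refine IsCompact.image (isCompact_of_isClosed_isBounded (isClosed_closedBall.preimage hπc)
      (isBounded_closedBall (x := p₀) (r := (R * r + K) / c) |>.subset fun v hv => ?_)) hπc
    rw [mem_preimage, mem_closedBall] at hv
    rw [mem_closedBall, dist_eq_norm, le_div_iff₀' hc]
    linarith [hcp (v - p₀), (abs_le.1 (hd v p₀)).1]
  · intro ε hε
    refine ⟨max ((2 * K + 1) / ε) ((K + 1) / r), lt_max_of_lt_left (by positivity),
      fun R hR => ?_⟩
    have hRε := (le_max_left _ _).trans hR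
    have hRr := (le_max_right _ _).trans hR
    have hR0 : 0 < R := lt_of_lt_of_le (by positivity) hRr
    rw [div_le_iff₀ hε] at hRε
    rw [div_le_iff₀ hr] at hRr
    have hKR : 0 ≤ K / R := by positivity
    have hscale : ∀ v, p (R⁻¹ • v) = p v / R := fun v => by
      rw [map_smul_eq_mul, norm_inv, Real.norm_of_nonneg hR0.le, inv_mul_eq_div]
    obtain ⟨Z, mZ, f, g, hf, hg, hfg⟩ := @exists_common_metricSpace X (E N) (E N)
      (MetricSpace.divDist X hR0) (p.toMetricSpace hp) _ π (fun u => R⁻¹ • (u - p₀))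
      ((K + 1) / R) (by positivity) (fun u v => by
        change |dist (π u) (π v) / R - p (R⁻¹ • (u - p₀) - R⁻¹ • (v - p₀))| ≤ _
        rw [← smul_sub, sub_sub_sub_cancel_right, hscale, ← sub_div, abs_div, abs_of_pos hR0,
          mul_div_assoc']
        exact div_le_div_of_nonneg_right (by linarith [hd u v]) hR0.le)
    have hgp : ∀ u v, dist (g u) (g v) = p (u - v) := hg
    have hbound : (K + 1) / R + K / R ≤ ε := by
      rw [← add_div, div_le_iff₀ hR0]
      linarith
    refine ⟨Z, mZ, f, g, fun x _ y _ => hf x y, fun u _ v _ => hg u v,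
      hausdorffDist_le_of_mem_dist hε.le ?_ ?_⟩
    · rintro _ ⟨x, hx, rfl⟩
      obtain ⟨u, rfl⟩ := hπsurj x
      have hu : p (R⁻¹ • (u - p₀)) ≤ r + K / R := by
        rw [hscale, div_le_iff₀ hR0, add_mul, div_mul_cancel₀ _ hR0.ne']
        rw [mem_closedBall] at hx
        linarith [(abs_le.1 (hd u p₀)).1]
      obtain ⟨w, hw, hvw⟩ := p.exists_le_sub_le hr.le hKR hu
      refine ⟨g w, mem_image_of_mem g hw, (dist_triangle _ (g (R⁻¹ • (u - p₀))) _).trans ?_⟩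
      rw [hfg u, hgp]
      linarith
    · rintro _ ⟨v, hv, rfl⟩
      have hrK : 0 ≤ r - K / R := by
        rw [sub_nonneg, div_le_iff₀ hR0]
        linarith
      obtain ⟨w, hw, hvw⟩ := p.exists_le_sub_le hrK hKR (v := v)
        (by rwa [sub_add_cancel])
      have hw' : R⁻¹ • ((p₀ + R • w) - p₀) = w := by
        rw [add_sub_cancel_left, inv_smul_smul₀ hR0.ne']
      refine ⟨f (π (p₀ + R • w)), mem_image_of_mem f ?_, (dist_triangle _ (g w) _).trans ?_⟩
      · rw [mem_closedBall]
        have h := (abs_le.1 (hd (p₀ + R • w) p₀)).2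
        rw [← hw', hscale, div_le_iff₀ hR0, sub_mul, div_mul_cancel₀ _ hR0.ne'] at hw
        linarith
      · have h := hfg (p₀ + R • w)
        rw [hw', dist_comm] at h
        rw [h, hgp]
        linarith
end
end

section
/- Let (Z, d) be a metric space, N ≥ 1, F a norm on ℝ^N, and φ : ℝ^N → Z a map that is Lipschitz (with respect to the Euclidean metric on ℝ^N) and satisfies F(y₁ − y₂) ≤ d(φ(y₁), φ(y₂)) for all y₁, y₂ ∈ ℝ^N. Define d^F(p, q) := inf{d(p, φ(y₁)) + F(y₁ − y₂) + d(φ(y₂), q) : y₁, y₂ ∈ ℝ^N} and d'(p, q) := min{d(p, q), d^F(p, q)}. Then d' is a metric on Z: it is symmetric, vanishes exactly on the diagonal, and satisfies the triangle inequality. -/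
open scoped ENNReal NNReal
open Metric Set Filter MeasureTheory

noncomputable section

/-- A norm on a finite-dimensional normed space which is bounded above by a multiple of the given
norm also bounds it from above. -/
theorem exists_norm_le_mul_of_definite {V : Type*} [NormedAddCommGroup V] [NormedSpace ℝ V]
    [ProperSpace V] (F : V → ℝ)
    (hFadd : ∀ u v : V, F (u + v) ≤ F u + F v)
    (hFsmul : ∀ (a : ℝ) (v : V), F (a • v) = |a| * F v)
    (hFnonneg : ∀ v : V, 0 ≤ F v)
    (hFdef : ∀ v : V, F v = 0 → v = 0)
    (K : ℝ≥0) (hFle : ∀ v : V, F v ≤ K * ‖v‖) :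
    ∃ C : ℝ, 0 ≤ C ∧ ∀ v : V, ‖v‖ ≤ C * F v := by
  have hcont : Continuous F := by
    refine (LipschitzWith.of_le_add_mul K fun x y => ?_).continuous
    have h1 := hFadd y (x - y)
    have h2 := hFle (x - y)
    rw [add_sub_cancel] at h1
    rw [dist_eq_norm]
    linarith
  rcases (sphere (0 : V) 1).eq_empty_or_nonempty with hS | hS
  · refine ⟨0, le_rfl, fun v => ?_⟩
    by_contra hv
    have hv0 : v ≠ 0 := by
      rintro rfl
      simp at hv
    have hmem : (‖v‖⁻¹ • v) ∈ sphere (0 : V) 1 := by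
      rw [mem_sphere_zero_iff_norm, norm_smul, norm_inv, norm_norm,
        inv_mul_cancel₀ (norm_ne_zero_iff.2 hv0)]
    simp [hS] at hmem
  · obtain ⟨u, hu, hmin⟩ := (isCompact_sphere (0 : V) 1).exists_isMinOn hS hcont.continuousOn
    have hFu : 0 < F u := by
      refine (hFnonneg u).lt_of_ne fun h => ?_
      rw [hFdef u h.symm] at hu
      simp at hu
    refine ⟨(F u)⁻¹, inv_nonneg.2 hFu.le, fun v => ?_⟩
    rw [inv_mul_eq_div, le_div_iff₀ hFu]
    by_cases hv0 : v = 0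
    · subst hv0
      simpa using hFnonneg 0
    have hpos : 0 < ‖v‖ := norm_pos_iff.2 hv0
    have hmem : (‖v‖⁻¹ • v) ∈ sphere (0 : V) 1 := by
      rw [mem_sphere_zero_iff_norm, norm_smul, norm_inv, norm_norm, inv_mul_cancel₀ hpos.ne']
    have h : F u ≤ F (‖v‖⁻¹ • v) := hmin hmem
    rwa [hFsmul, abs_of_pos (inv_pos.2 hpos), inv_mul_eq_div, le_div_iff₀ hpos, mul_comm] at h

/-- the modified distance `d' = min (d, d^F)` is a metric on `Z`:
symmetric, vanishing exactly on the diagonal, and satisfying the triangle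
inequality. -/
theorem modified_distance_is_metric
    {N : ℕ} (hN : 1 ≤ N) {Z : Type*} [MetricSpace Z]
    (F : E N → ℝ)
    (hFadd : ∀ u v : E N, F (u + v) ≤ F u + F v)
    (hFsmul : ∀ (a : ℝ) (v : E N), F (a • v) = |a| * F v)
    (hFdef : ∀ v : E N, F v = 0 → v = 0)
    (φ : E N → Z) (ℓ : ℝ) (hℓ : 0 ≤ ℓ)
    (hφlip : ∀ y₁ y₂ : E N, dist (φ y₁) (φ y₂) ≤ ℓ * dist y₁ y₂)
    (hφlow : ∀ y₁ y₂ : E N, F (y₁ - y₂) ≤ dist (φ y₁) (φ y₂)) :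
    let dF : Z → Z → ℝ := fun p q =>
      sInf {c : ℝ | ∃ y₁ y₂ : E N,
        c = dist p (φ y₁) + F (y₁ - y₂) + dist (φ y₂) q}
    let d' : Z → Z → ℝ := fun p q => min (dist p q) (dF p q)
    (∀ p q : Z, d' p q = d' q p) ∧
    (∀ p q : Z, d' p q = 0 ↔ p = q) ∧
    (∀ p q s : Z, d' p s ≤ d' p q + d' q s) := by
  intro dF d'
  have hF0 : F 0 = 0 := by simpa using hFsmul 0 0
  have hFneg (v : E N) : F (-v) = F v := by simpa using hFsmul (-1) v
  have hFnonneg (v : E N) : 0 ≤ F v := by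
    have h := hFadd v (-v)
    rw [add_neg_cancel, hF0, hFneg] at h
    linarith
  have dF_le (p q : Z) (y₁ y₂ : E N) :
      dF p q ≤ dist p (φ y₁) + F (y₁ - y₂) + dist (φ y₂) q := by
    refine csInf_le ⟨0, ?_⟩ ⟨y₁, y₂, rfl⟩
    rintro c ⟨z₁, z₂, rfl⟩
    have := hFnonneg (z₁ - z₂)
    positivity
  have le_dF (p q : Z) (x : ℝ)
      (h : ∀ y₁ y₂ : E N, x ≤ dist p (φ y₁) + F (y₁ - y₂) + dist (φ y₂) q) : x ≤ dF p q := by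
    refine le_csInf ⟨_, 0, 0, rfl⟩ ?_
    rintro c ⟨y₁, y₂, rfl⟩
    exact h y₁ y₂
  have dF_symm_le (p q : Z) : dF p q ≤ dF q p := by
    refine le_dF q p _ fun y₁ y₂ => (dF_le p q y₂ y₁).trans_eq ?_
    rw [← neg_sub y₁ y₂, hFneg, dist_comm p, dist_comm _ q]
    ring
  have dF_symm (p q : Z) : dF p q = dF q p := (dF_symm_le p q).antisymm (dF_symm_le q p)
  have dF_le_dist_add (p q s : Z) : dF p s ≤ dist p q + dF q s := by
    rw [← sub_le_iff_le_add']
    refine le_dF q s _ fun y₁ y₂ => ?_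
    linarith [dF_le p s y₁ y₂, dist_triangle p q (φ y₁)]
  have dF_triangle (p q s : Z) : dF p s ≤ dF p q + dF q s := by
    rw [← sub_le_iff_le_add]
    refine le_dF p q _ fun y₁ y₂ => ?_
    rw [sub_le_comm]
    refine le_dF q s _ fun y₃ y₄ => ?_
    have h₁ := hFadd (y₁ - y₂) (y₂ - y₃ + (y₃ - y₄))
    have h₂ := hFadd (y₂ - y₃) (y₃ - y₄)
    rw [show y₁ - y₂ + (y₂ - y₃ + (y₃ - y₄)) = y₁ - y₄ by abel] at h₁
    linarith [dF_le p s y₁ y₄, hφlow y₂ y₃, dist_triangle (φ y₂) q (φ y₃)]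
  have hFle (v : E N) : F v ≤ ℓ * ‖v‖ := by
    simpa using (hφlow v 0).trans (hφlip v 0)
  obtain ⟨C, hC, hnorm⟩ :=
    exists_norm_le_mul_of_definite F hFadd hFsmul hFnonneg hFdef ⟨ℓ, hℓ⟩ hFle
  have dist_le_dF (p q : Z) : dist p q ≤ (1 + ℓ * C) * dF p q := by
    have hK : 0 < 1 + ℓ * C := by positivity
    rw [← div_le_iff₀' hK]
    refine le_dF p q _ fun y₁ y₂ => ?_
    rw [div_le_iff₀' hK]
    have h₁ := hφlip y₁ y₂
    have h₂ := mul_le_mul_of_nonneg_left (hnorm (y₁ - y₂)) hℓ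
    rw [dist_eq_norm y₁ y₂] at h₁
    have h₃ : 0 ≤ ℓ * C * (dist p (φ y₁) + dist (φ y₂) q) := by positivity
    linarith [hFnonneg (y₁ - y₂), dist_triangle4 p (φ y₁) (φ y₂) q]
  refine ⟨fun p q => ?_, fun p q => ⟨fun h => ?_, ?_⟩, fun p q s => ?_⟩
  · simp only [d', dist_comm p q, dF_symm p q]
  · rcases min_choice (dist p q) (dF p q) with h' | h'
    · exact dist_eq_zero.1 (h'.symm.trans h)
    · have h₀ := dist_le_dF p q
      rw [h'.symm.trans h, mul_zero] at h₀
      exact dist_le_zero.1 h₀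
  · rintro rfl
    refine (min_eq_left ?_).trans (dist_self p)
    rw [dist_self]
    refine le_dF p p _ fun y₁ y₂ => ?_
    have := hFnonneg (y₁ - y₂)
    positivity
  · rcases min_choice (dist p q) (dF p q) with h₁ | h₁ <;>
      rcases min_choice (dist q s) (dF q s) with h₂ | h₂ <;>
      simp only [d', h₁, h₂]
    · exact (min_le_left _ _).trans (dist_triangle p q s)
    · exact (min_le_right _ _).trans (dF_le_dist_add p q s)
    · refine (min_le_right _ _).trans ?_
      rw [dF_symm p s, dF_symm p q, dist_comm q s, add_comm]
      exact dF_le_dist_add s q p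
    · exact (min_le_right _ _).trans (dF_triangle p q s)
end
end

section
/- Let (Z, d) be a metric space, N ≥ 1, F a norm on ℝ^N, and φ : ℝ^N → Z a map that is Lipschitz (with respect to the Euclidean metric on ℝ^N) and satisfies F(y₁ − y₂) ≤ d(φ(y₁), φ(y₂)) for all y₁, y₂ ∈ ℝ^N. Define d^F(p, q) := inf{d(p, φ(y₁)) + F(y₁ − y₂) + d(φ(y₂), q) : y₁, y₂ ∈ ℝ^N} and d'(p, q) := min{d(p, q), d^F(p, q)}. Then φ is distance preserving from (ℝ^N, d_F), where d_F(u, v) := F(u − v), into (Z, d'): for all y₁, y₂ ∈ ℝ^N, d'(φ(y₁), φ(y₂)) = F(y₁ − y₂). -/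
open scoped ENNReal NNReal
open Metric Set Filter MeasureTheory

noncomputable section

theorem le_add_add_of_le_dist {V Z : Type*} [AddCommGroup V] [PseudoMetricSpace Z]
    {F : V → ℝ} (hFadd : ∀ u v, F (u + v) ≤ F u + F v) {φ : V → Z}
    (hφlow : ∀ y₁ y₂, F (y₁ - y₂) ≤ dist (φ y₁) (φ y₂)) (u v y₁ y₂ : V) :
    F (u - v) ≤ dist (φ u) (φ y₁) + F (y₁ - y₂) + dist (φ y₂) (φ v) := by
  have h : F ((u - y₁) + (y₁ - y₂) + (y₂ - v)) ≤ F (u - y₁) + F (y₁ - y₂) + F (y₂ - v) :=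
    (hFadd _ _).trans (add_le_add_left (hFadd _ _) _)
  rw [sub_add_sub_cancel, sub_add_sub_cancel] at h
  linarith [hφlow u y₁, hφlow y₂ v]

/-- with the modified distance `d' = min (d, d^F)`, the map `φ` is
distance preserving from `(ℝ^N, d_F)` into `(Z, d')`. -/
theorem modified_distance_embedding_isometric
    {N : ℕ} (hN : 1 ≤ N) {Z : Type*} [MetricSpace Z]
    (F : E N → ℝ)
    (hFadd : ∀ u v : E N, F (u + v) ≤ F u + F v)
    (hFsmul : ∀ (a : ℝ) (v : E N), F (a • v) = |a| * F v)
    (hFdef : ∀ v : E N, F v = 0 → v = 0)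
    (φ : E N → Z) (ℓ : ℝ) (hℓ : 0 ≤ ℓ)
    (hφlip : ∀ y₁ y₂ : E N, dist (φ y₁) (φ y₂) ≤ ℓ * dist y₁ y₂)
    (hφlow : ∀ y₁ y₂ : E N, F (y₁ - y₂) ≤ dist (φ y₁) (φ y₂)) :
    let dF : Z → Z → ℝ := fun p q =>
      sInf {c : ℝ | ∃ y₁ y₂ : E N,
        c = dist p (φ y₁) + F (y₁ - y₂) + dist (φ y₂) q}
    let d' : Z → Z → ℝ := fun p q => min (dist p q) (dF p q)
    ∀ y₁ y₂ : E N, d' (φ y₁) (φ y₂) = F (y₁ - y₂) := by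
  intro dF d' u v
  have h_least : IsLeast {c : ℝ | ∃ y₁ y₂ : E N,
      c = dist (φ u) (φ y₁) + F (y₁ - y₂) + dist (φ y₂) (φ v)} (F (u - v)) := by
    refine ⟨⟨u, v, by simp⟩, ?_⟩
    rintro c ⟨y₁, y₂, rfl⟩
    exact le_add_add_of_le_dist hFadd hφlow u v y₁ y₂
  have h_dF : dF (φ u) (φ v) = F (u - v) := h_least.csInf_eq
  change min (dist (φ u) (φ v)) (dF (φ u) (φ v)) = F (u - v)
  rw [h_dF, min_eq_right (hφlow u v)]
end
end
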